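/- Let m ≥ 3 and let p be a prime with m² ≤ p. Suppose L₁, …, L_m are pairwise disjoint subsets of ZMod p whose union is all of ZMod p, and each L_i is an arc, i.e., L_i = {a_i, a_i + 1, …, a_i + ℓ_i − 1} (reduced modulo p) for some a_i ∈ ZMod p and some length ℓ_i with ⌊p/m⌋ ≤ ℓ_i ≤ ⌈p/m⌉. Then for every pair of indices (i, j), the number of indices k such that there exist u ∈ L_i, v ∈ L_j, w ∈ L_k with u + v + w = 0 is at most 10. In particular, the number of triples (i, j, k) with 0 ∈ L_i + L_j + L_k is at most 10·m². -/

import Mathlib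

/-- Splitting `ZMod p` into `m` pairwise disjoint arcs of nearly equal size
(each length between `⌊p/m⌋` and `⌈p/m⌉`), for each pair `(i, j)` at most `10`
indices `k` admit `u ∈ L i`, `v ∈ L j`, `w ∈ L k` with `u + v + w = 0`; hence at
most `10·m²` triples `(i, j, k)` have `0 ∈ L i + L j + L k`. -/
theorem arcs_zero_sum_triples_bound (m p : ℕ) [Fact p.Prime] (hm : 3 ≤ m)
    (hmp : m ^ 2 ≤ p)
    (L : Fin m → Finset (ZMod p)) (a : Fin m → ZMod p) (ℓ : Fin m → ℕ)
    (hlen : ∀ i, p / m ≤ ℓ i ∧ ℓ i ≤ (p + m - 1) / m)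
    (harc : ∀ i, L i = (Finset.range (ℓ i)).image (fun r : ℕ => a i + (r : ZMod p)))
    (hdisj : ∀ i j, i ≠ j → Disjoint (L i) (L j))
    (hcover : ∀ x : ZMod p, ∃ i, x ∈ L i) :
    (∀ i j : Fin m,
        (Finset.univ.filter fun k : Fin m =>
          ∃ u ∈ L i, ∃ v ∈ L j, ∃ w ∈ L k, u + v + w = 0).card ≤ 10) ∧
    (Finset.univ.filter fun ijk : Fin m × Fin m × Fin m =>
        ∃ u ∈ L ijk.1, ∃ v ∈ L ijk.2.1, ∃ w ∈ L ijk.2.2, u + v + w = 0).card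
      ≤ 10 * m ^ 2 := by
  classical
  have hm0 : 0 < m := by omega
  obtain ⟨q, hq⟩ : ∃ q, q = p / m := ⟨_, rfl⟩
  have hqm : m ≤ q := by
    rw [hq, Nat.le_div_iff_mul_le hm0]; nlinarith
  have hqp : q * m ≤ p := by rw [hq]; exact Nat.div_mul_le_self p m
  have hqp1 : q + 1 ≤ p := by nlinarith
  have hl : ∀ i, q ≤ ℓ i ∧ ℓ i ≤ q + 1 := by
    intro i
    refine ⟨hq ▸ (hlen i).1, (hlen i).2.trans ?_⟩
    calc (p + m - 1) / m ≤ (p + m) / m := Nat.div_le_div_right (by omega)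
      _ = q + 1 := by rw [Nat.add_div_right _ hm0, hq]
  have hcard : ∀ k, q ≤ (L k).card := by
    intro k
    rw [harc k, Finset.card_image_of_injOn, Finset.card_range]
    · exact (hl k).1
    · intro x hx y hy hxy
      have h1 := (hl k).2
      have hx' : x < ℓ k := by simpa using hx
      have hy' : y < ℓ k := by simpa using hy
      have h2 : (x : ZMod p) = (y : ZMod p) := add_left_cancel hxy
      rw [ZMod.natCast_eq_natCast_iff'] at h2
      rwa [Nat.mod_eq_of_lt (by omega), Nat.mod_eq_of_lt (by omega)] at h2
  have key : ∀ i j : Fin m,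
        (Finset.univ.filter fun k : Fin m =>
          ∃ u ∈ L i, ∃ v ∈ L j, ∃ w ∈ L k, u + v + w = 0).card ≤ 10 := by
    intro i j
    set S := Finset.univ.filter fun k : Fin m =>
          ∃ u ∈ L i, ∃ v ∈ L j, ∃ w ∈ L k, u + v + w = 0 with hS
    have hsub : S.biUnion L ⊆ (Finset.range (4 * q + 1)).image
        (fun n : ℕ => -(a i + a j) - ((3 * q : ℕ) : ZMod p) + (n : ZMod p)) := by
      intro x hx
      obtain ⟨k, hk, hxk⟩ := Finset.mem_biUnion.1 hx
      obtain ⟨u, hu, v, hv, w, hw, h0⟩ := (Finset.mem_filter.1 hk).2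
      rw [harc, Finset.mem_image] at hu hv hw hxk
      obtain ⟨r, hr, rfl⟩ := hu
      obtain ⟨s, hs, rfl⟩ := hv
      obtain ⟨t, ht, rfl⟩ := hw
      obtain ⟨t', ht', rfl⟩ := hxk
      rw [Finset.mem_range] at hr hs ht ht'
      have h1 := (hl i).2
      have h2 := (hl j).2
      have h3 := (hl k).2
      obtain ⟨n, hn⟩ : ∃ n, n + (r + s + t) = 3 * q + t' :=
        ⟨3 * q + t' - (r + s + t), by omega⟩
      refine Finset.mem_image.2 ⟨n, Finset.mem_range.2 (by omega), ?_⟩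
      have hn' := congrArg (Nat.cast : ℕ → ZMod p) hn
      push_cast at hn' ⊢
      linear_combination hn' - h0
    have hc := Finset.card_le_card hsub
    rw [Finset.card_biUnion (fun x _ y _ hxy => hdisj x y hxy)] at hc
    have hc2 := hc.trans Finset.card_image_le
    rw [Finset.card_range] at hc2
    have hc3 : S.card * q ≤ ∑ k ∈ S, (L k).card := by
      rw [← smul_eq_mul]
      exact Finset.card_nsmul_le_sum _ _ _ (fun k _ => hcard k)
    by_contra hcon
    have : 11 ≤ S.card := by omega
    nlinarith
  refine ⟨key, ?_⟩
  rw [Finset.card_filter, Fintype.sum_prod_type]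
  simp_rw [Fintype.sum_prod_type]
  simp_rw [← Finset.card_filter]
  calc _ ≤ ∑ _i : Fin m, ∑ _j : Fin m, 10 :=
        Finset.sum_le_sum fun i _ => Finset.sum_le_sum fun j _ => key i j
    _ = 10 * m ^ 2 := by simp; ring
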